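/- Let M ∈ F_2^{m×n}, b ∈ F_2^m, let G = G(M,b), and let u be a magic unitary over a unital C*-algebra indexed by V(G) satisfying the Qut(G) relations. Fix i ∈ [n]. Then the element Σ_{β ∈ ±1^{S_k}_{b_k}} α_i β_i · u_{(k,α),(k,β)} is the same for every choice of k ∈ [m] with i ∈ S_k and every choice of α ∈ ±1^{S_k}_{b_k}. -/

import Mathlib

open scoped BigOperators

/-- A magic unitary over a ring with star: every entry is a projection and
every row and column sums to `1`. -/
def IsMagicUnitary {I J A : Type*} [Fintype I] [Fintype J] [Ring A] [StarRing A]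
    (u : I → J → A) : Prop :=
  (∀ i j, star (u i j) = u i j) ∧ (∀ i j, u i j * u i j = u i j) ∧
    (∀ i, ∑ j, u i j = 1) ∧ (∀ j, ∑ i, u i j = 1)

/-- The sign `(-1)^x` for `x ∈ F₂`. -/
def signZ (x : ZMod 2) : ℤˣ := if x = 0 then 1 else -1

/-- `S_k = {i : M k i = 1}`. -/
def Sk {m n : ℕ} (M : Matrix (Fin m) (Fin n) (ZMod 2)) (k : Fin m) : Finset (Fin n) :=
  Finset.univ.filter fun i => M k i = 1

/-- The vertex set of the colored graph `G(M,b)`: pairs `(k, α)` where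
`α : ±1^{S_k}` with `∏_{i ∈ S_k} α i = (-1)^{b k}`, encoded as functions on `Fin n`
normalized to `1` off `S_k`. -/
abbrev GVertex {m n : ℕ} (M : Matrix (Fin m) (Fin n) (ZMod 2)) (b : Fin m → ZMod 2) : Type :=
  {p : Fin m × (Fin n → ℤˣ) //
    (∀ i, i ∉ Sk M p.1 → p.2 i = 1) ∧ ∏ i ∈ Sk M p.1, p.2 i = signZ (b p.1)}

/-- `v` and `w` are joined by an edge of color `({l,k}, δ|_{S_l ∩ S_k})` in `G(M,b)`. -/
def adjC {m n : ℕ} (M : Matrix (Fin m) (Fin n) (ZMod 2)) (b : Fin m → ZMod 2)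
    (l k : Fin m) (δ : Fin n → ℤˣ) (v w : GVertex M b) : Prop :=
  ((v.1.1 = l ∧ w.1.1 = k) ∨ (v.1.1 = k ∧ w.1.1 = l)) ∧ v ≠ w ∧
    (Sk M l ∩ Sk M k).Nonempty ∧
    ∀ i ∈ Sk M l ∩ Sk M k, v.1.2 i * w.1.2 i = δ i

open Classical in
/-- The 0/1 adjacency matrix (with entries in `A`) of the color class
`({l,k}, δ|_{S_l ∩ S_k})` of the colored graph `G(M,b)`. -/
noncomputable def adjMat (A : Type*) [Zero A] [One A] {m n : ℕ}
    (M : Matrix (Fin m) (Fin n) (ZMod 2)) (b : Fin m → ZMod 2)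
    (l k : Fin m) (δ : Fin n → ℤˣ) (v w : GVertex M b) : A :=
  if adjC M b l k δ v w then 1 else 0

/-- `u` satisfies the `Qut(G(M,b))` relations: entries vanish between distinct
vertex colors, and `u` commutes with every edge-color adjacency matrix. -/
def QutRel (A : Type*) [Ring A] {m n : ℕ} (M : Matrix (Fin m) (Fin n) (ZMod 2))
    (b : Fin m → ZMod 2) (u : GVertex M b → GVertex M b → A) : Prop :=
  (∀ v w : GVertex M b, v.1.1 ≠ w.1.1 → u v w = 0) ∧
  ∀ (l k : Fin m) (δ : Fin n → ℤˣ) (v w : GVertex M b),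
    ∑ x, adjMat A M b l k δ v x * u x w = ∑ x, u v x * adjMat A M b l k δ x w

section BanachAlgebra

variable {A : Type*} [NormedRing A] [NormedAlgebra ℂ A] [CompleteSpace A]

/-- If `p` acts as a unit on `h`, then every nonzero point `z` of the spectrum of `h` satisfies
`‖c + d * z‖ ≤ ‖c • p + d • h‖`. -/
theorem norm_add_mul_le_of_mem_spectrum {h p : A} (hp : h * p = h) (hp' : p * h = h) {c d : ℂ}
    {r : ℝ} (hr : ‖c • p + d • h‖ ≤ r) {z : ℂ} (hz : z ∈ spectrum ℂ h) (hz0 : z ≠ 0) :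
    ‖c + d * z‖ ≤ r := by
  set y := c • p + d • h with hy
  have hyh : y * h = h * y := by simp [hy, add_mul, mul_add, hp, hp']
  have hxy : h * (algebraMap ℂ A c + d • h) = h * y := by
    simp [hy, mul_add, hp, Algebra.algebraMap_eq_smul_one]
  have hpow (n : ℕ) : h * (algebraMap ℂ A c + d • h) ^ n = h * y ^ n := by
    induction n with
    | zero => simp
    | succ n ih => rw [pow_succ', ← mul_assoc, hxy, ← hyh, mul_assoc, ih, ← mul_assoc, hyh,
        mul_assoc, ← pow_succ']
  have hr0 : 0 ≤ r := (norm_nonneg _).trans hr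
  have hnorm (n : ℕ) : ‖h * y ^ n‖ ≤ ‖h‖ * r ^ n := by
    induction n with
    | zero => simp
    | succ n ih =>
      rw [pow_succ, ← mul_assoc, pow_succ, ← mul_assoc]
      exact (norm_mul_le _ _).trans (mul_le_mul ih hr (norm_nonneg _) (by positivity))
  have hbound (n : ℕ) : ‖z‖ * ‖c + d * z‖ ^ n ≤ ‖h‖ * r ^ n * ‖(1 : A)‖ := by
    have hmem := spectrum.subset_polynomial_aeval h
      (Polynomial.X * (Polynomial.C c + Polynomial.C d * Polynomial.X) ^ n) ⟨z, hz, rfl⟩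
    have hle := spectrum.norm_le_norm_mul_of_mem hmem
    simp only [Polynomial.eval_mul, Polynomial.eval_X, Polynomial.eval_pow, Polynomial.eval_add,
      Polynomial.eval_C, map_mul, Polynomial.aeval_X, map_pow, map_add, Polynomial.aeval_C,
      ← Algebra.smul_def, hpow, norm_mul, norm_pow] at hle
    exact hle.trans (mul_le_mul_of_nonneg_right (hnorm n) (norm_nonneg _))
  by_contra! hlt
  have hs : 0 < ‖c + d * z‖ := hr0.trans_lt hlt
  have hlim : Filter.Tendsto (fun n : ℕ => ‖h‖ * ‖(1 : A)‖ * (r / ‖c + d * z‖) ^ n)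
      Filter.atTop (nhds (‖h‖ * ‖(1 : A)‖ * 0)) :=
    (tendsto_pow_atTop_nhds_zero_of_lt_one (by positivity)
      ((div_lt_one hs).2 hlt)).const_mul _
  have hle : ‖z‖ ≤ ‖h‖ * ‖(1 : A)‖ * 0 := ge_of_tendsto' hlim fun n => by
    rw [div_pow, mul_div_assoc', le_div_iff₀ (by positivity)]
    linarith [hbound n]
  exact hz0 (norm_le_zero_iff.1 (by simpa using hle))

/-- The spectral radius of a self-adjoint element equals its norm. The involution is not assumed to
be conjugate-linear. -/
theorem spectralRadius_eq_nnnorm_of_isSelfAdjoint [StarRing A] [CStarRing A] {a : A}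
    (ha : IsSelfAdjoint a) : spectralRadius ℂ a = ‖a‖₊ := by
  have hconst : Filter.Tendsto (fun _ : ℕ => (‖a‖₊ : ENNReal)) Filter.atTop _ :=
    tendsto_const_nhds
  refine tendsto_nhds_unique ?_ hconst
  convert! (spectrum.pow_nnnorm_pow_one_div_tendsto_nhds_spectralRadius (a : A)).comp
    (tendsto_pow_atTop_atTop_of_one_lt one_lt_two) using 1
  refine funext fun n => ?_
  rw [Function.comp_apply, ha.nnnorm_pow_two_pow, ENNReal.coe_pow, ← ENNReal.rpow_natCast,
    ← ENNReal.rpow_mul]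
  simp

/-- A self-adjoint element whose spectrum is contained in `{0}` vanishes. -/
theorem eq_zero_of_isSelfAdjoint_of_spectrum [StarRing A] [CStarRing A] {a : A}
    (ha : IsSelfAdjoint a) (hsp : ∀ z ∈ spectrum ℂ a, z = 0) : a = 0 := by
  have hrad : spectralRadius ℂ a = 0 := by
    simp only [spectralRadius, ENNReal.iSup_eq_zero]
    intro z hz
    simp [hsp z hz]
  rw [spectralRadius_eq_nnnorm_of_isSelfAdjoint ha] at hrad
  simpa using hrad

theorem Complex.eq_zero_of_norm_natCast_add_le_of_norm_one_sub_le {z : ℂ} {N : ℕ}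
    (h₁ : ‖(N : ℂ) + z‖ ≤ N) (h₂ : ‖1 - 2 * z‖ ≤ 1) : z = 0 := by
  have hN : (0 : ℝ) ≤ N := N.cast_nonneg
  have e₁ := pow_le_pow_left₀ (norm_nonneg _) h₁ 2
  have e₂ := pow_le_pow_left₀ (norm_nonneg _) h₂ 2
  rw [Complex.sq_norm, Complex.normSq_apply] at e₁ e₂
  simp at e₁ e₂
  have hre : 0 ≤ z.re := by nlinarith [sq_nonneg z.re, sq_nonneg z.im]
  have hsum : z.re * z.re + z.im * z.im ≤ 0 := by nlinarith [mul_nonneg hN hre]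
  exact Complex.normSq_eq_zero.1 (le_antisymm (by rwa [Complex.normSq_apply])
    (Complex.normSq_nonneg z))

/-- Projections in a finite family with sum `1` are pairwise orthogonal. The involution is not
assumed to be conjugate-linear. -/
theorem IsStarProjection.mul_eq_zero_of_sum_eq_one [StarRing A] [CStarRing A] {ι : Type*}
    [Fintype ι] {p : ι → A} (hp : ∀ j, IsStarProjection (p j)) (hsum : ∑ j, p j = 1) {j k : ι}
    (hjk : j ≠ k) : p k * p j = 0 := by
  classical
  have hj := (hp j).isIdempotentElem.eq
  have hk := (hp k).isIdempotentElem.eq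
  have hsj := (hp j).isSelfAdjoint.star_eq
  have hsk := (hp k).isSelfAdjoint.star_eq
  set h := p j * p k * p j with hh
  have hhstar : h = star (p k * p j) * (p k * p j) := by
    rw [star_mul, hsj, hsk, hh, mul_assoc, mul_assoc, ← mul_assoc (p k) (p k), hk]
  have hself : IsSelfAdjoint h := hhstar ▸ IsSelfAdjoint.star_mul_self _
  have hhp : h * p j = h := by rw [hh, mul_assoc, hj]
  have hph : p j * h = h := by rw [hh, ← mul_assoc, ← mul_assoc, hj]
  have hcompress (x : A) : ‖p j * x * p j‖ ≤ ‖x‖ := by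
    have hle := (hp j).norm_le
    calc ‖p j * x * p j‖ ≤ ‖p j‖ * ‖x‖ * ‖p j‖ := norm_mul₃_le
      _ ≤ 1 * ‖x‖ * 1 := by gcongr
      _ = ‖x‖ := by ring
  set T := (Finset.univ.erase j).erase k with hT
  have hrest : ∑ l ∈ T, p l = 1 - p j - p k := by
    rw [← hsum, hT, Finset.sum_erase_eq_sub (by simp [hjk.symm]),
      Finset.sum_erase_eq_sub (Finset.mem_univ _)]
  have hpos : ‖((T.card : ℕ) : ℂ) • p j + (1 : ℂ) • h‖ ≤ T.card := by
    have heq : ((T.card : ℕ) : ℂ) • p j + (1 : ℂ) • h = p j * (∑ l ∈ T, (1 - p l)) * p j := by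
      rw [Finset.sum_sub_distrib, hrest, Nat.cast_smul_eq_nsmul]
      simp only [Finset.sum_const, one_smul, mul_sub, sub_mul, mul_one, hj, hh, mul_smul_comm,
        smul_mul_assoc]
      abel
    rw [heq]
    refine (hcompress _).trans ((norm_sum_le _ _).trans ?_)
    simpa using Finset.sum_le_card_nsmul T _ 1 fun l _ => (hp l).one_sub.norm_le
  have hrefl : ‖(1 : ℂ) • p j + (-2 : ℂ) • h‖ ≤ 1 := by
    have heq : (1 : ℂ) • p j + (-2 : ℂ) • h = p j * (1 - (2 : ℂ) • p k) * p j := by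
      rw [mul_sub, sub_mul, mul_one, hj, mul_smul_comm, smul_mul_assoc, neg_smul, one_smul,
        ← sub_eq_add_neg]
    have hunit : star (1 - (p k + p k)) * (1 - (p k + p k)) = 1 := by
      simp only [star_sub, star_one, star_add, hsk, mul_sub, sub_mul, mul_add, add_mul, hk, mul_one,
        one_mul]
      abel
    rw [heq, two_smul]
    refine (hcompress _).trans ?_
    have hsq := CStarRing.norm_star_mul_self (x := 1 - (p k + p k))
    rw [hunit] at hsq
    have hone : ‖(1 : A)‖ ≤ 1 := (IsStarProjection.one A).norm_le
    nlinarith [norm_nonneg (1 - (p k + p k))]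
  have hzero : h = 0 := by
    refine eq_zero_of_isSelfAdjoint_of_spectrum hself fun z hz => ?_
    by_contra hz0
    refine hz0 (Complex.eq_zero_of_norm_natCast_add_le_of_norm_one_sub_le (N := T.card) ?_ ?_)
    · simpa using norm_add_mul_le_of_mem_spectrum hhp hph hpos hz hz0
    · simpa [sub_eq_add_neg] using norm_add_mul_le_of_mem_spectrum hhp hph hrefl hz hz0
  exact CStarRing.star_mul_self_eq_zero_iff _ |>.1 (hhstar ▸ hzero)

end BanachAlgebra

section QuantumAutomorphism

variable {m n : ℕ} {M : Matrix (Fin m) (Fin n) (ZMod 2)} {b : Fin m → ZMod 2} {A : Type*} [Ring A]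
  {u : GVertex M b → GVertex M b → A}

/-- Entries of `u` indexed by an edge and by a pair not joined by an edge of the same color have
product zero. -/
theorem QutRel.mul_eq_zero (hqut : QutRel A M b u) (hidem : ∀ v w, u v w * u v w = u v w)
    (hrow : ∀ v w w', w ≠ w' → u v w * u v w' = 0)
    (hcol : ∀ v v' w, v ≠ v' → u v w * u v' w = 0) {l k : Fin m} {δ : Fin n → ℤˣ}
    {v v' x x' : GVertex M b} (hv : adjC M b l k δ v v') (hx : ¬ adjC M b l k δ x x') :
    u v x * u v' x' = 0 := by
  have hleft : (∑ y, adjMat A M b l k δ v y * u y x') * u v' x' = u v' x' := by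
    rw [Finset.sum_mul, Finset.sum_eq_single v']
    · simp [adjMat, hv, hidem]
    · intro y _ hy
      rw [mul_assoc, hcol y v' x' hy, mul_zero]
    · simp
  have hright : u v x * ∑ y, u v y * adjMat A M b l k δ y x' = 0 := by
    rw [Finset.mul_sum]
    refine Finset.sum_eq_zero fun y _ => ?_
    rw [← mul_assoc]
    obtain rfl | hy := eq_or_ne x y
    · simp [adjMat, hx]
    · rw [hrow v x y hy, zero_mul]
  rw [← hleft, ← mul_assoc, hqut.2, hright, zero_mul]

/-- Color-preserving entries whose signs at a common coordinate disagree have product zero. -/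
theorem QutRel.mul_eq_zero_of_sign_ne (hqut : QutRel A M b u)
    (hidem : ∀ v w, u v w * u v w = u v w)
    (hrow : ∀ v w w', w ≠ w' → u v w * u v w' = 0)
    (hcol : ∀ v v' w, v ≠ v' → u v w * u v' w = 0) {i : Fin n} {v v' x x' : GVertex M b}
    (hvv' : v ≠ v') (hv : M v.1.1 i = 1) (hv' : M v'.1.1 i = 1)
    (hsign : v.1.2 i * x.1.2 i ≠ v'.1.2 i * x'.1.2 i) : u v x * u v' x' = 0 := by
  have hi : i ∈ Sk M v.1.1 ∩ Sk M v'.1.1 := by simp [Sk, hv, hv']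
  refine hqut.mul_eq_zero hidem hrow hcol (l := v.1.1) (k := v'.1.1)
    (δ := fun j => v.1.2 j * v'.1.2 j) ⟨Or.inl ⟨rfl, rfl⟩, hvv', ⟨i, hi⟩, fun _ _ => rfl⟩ ?_
  rintro ⟨-, -, -, hx⟩
  refine hsign ?_
  have hprod : x.1.2 i * x'.1.2 i = v.1.2 i * v'.1.2 i := hx i hi
  clear hsign
  generalize v.1.2 i = a at *
  generalize v'.1.2 i = a' at *
  generalize x.1.2 i = c at *
  generalize x'.1.2 i = c' at *
  revert a a' c c'
  decide

theorem QutRel.sum_filter_color_eq (hqut : QutRel A M b u) (v : GVertex M b)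
    (f : GVertex M b → ℤ) :
    ∑ w ∈ Finset.univ.filter (fun w : GVertex M b => w.1.1 = v.1.1), f w • u v w =
      ∑ w, f w • u v w := by
  refine Finset.sum_filter_of_ne fun w _ hw => ?_
  by_contra hne
  exact hw (by rw [hqut.1 v w (Ne.symm hne), smul_zero])

end QuantumAutomorphism

/-- For a magic unitary `u` satisfying the `Qut(G(M,b))` relations and `i ∈ [n]`, the
element `∑_{β} α_i β_i u_{(k,α),(k,β)}` does not depend on the choice of `k` with
`i ∈ S_k` nor on the choice of `α ∈ ±1^{S_k}_{b_k}`. -/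
theorem yWellDefined {m n : ℕ} (M : Matrix (Fin m) (Fin n) (ZMod 2)) (b : Fin m → ZMod 2)
    {A : Type*} [NormedRing A] [StarRing A] [CStarRing A] [NormedAlgebra ℂ A]
    [CompleteSpace A]
    (u : GVertex M b → GVertex M b → A)
    (hmu : IsMagicUnitary u) (hqut : QutRel A M b u) (i : Fin n) :
    ∀ v v' : GVertex M b, M v.1.1 i = 1 → M v'.1.1 i = 1 →
      (∑ w ∈ Finset.univ.filter (fun w : GVertex M b => w.1.1 = v.1.1),
        ((v.1.2 i * w.1.2 i : ℤˣ) : ℤ) • u v w)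
      = ∑ w ∈ Finset.univ.filter (fun w : GVertex M b => w.1.1 = v'.1.1),
        ((v'.1.2 i * w.1.2 i : ℤˣ) : ℤ) • u v' w := by
  intro v v' hv hv'
  obtain rfl | hvv' := eq_or_ne v v'
  · rfl
  obtain ⟨hstar, hidem, hrowsum, hcolsum⟩ := hmu
  have hproj (v w : GVertex M b) : IsStarProjection (u v w) := ⟨hidem v w, hstar v w⟩
  have hrow (v w w' : GVertex M b) (h : w ≠ w') : u v w * u v w' = 0 :=
    IsStarProjection.mul_eq_zero_of_sum_eq_one (hproj v) (hrowsum v) h.symm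
  have hcol (v v' w : GVertex M b) (h : v ≠ v') : u v w * u v' w = 0 :=
    IsStarProjection.mul_eq_zero_of_sum_eq_one (fun v => hproj v w) (hcolsum w) h.symm
  rw [hqut.sum_filter_color_eq v fun w => ((v.1.2 i * w.1.2 i : ℤˣ) : ℤ),
    hqut.sum_filter_color_eq v' fun w => ((v'.1.2 i * w.1.2 i : ℤˣ) : ℤ)]
  calc ∑ x, ((v.1.2 i * x.1.2 i : ℤˣ) : ℤ) • u v x
      = ∑ x, ∑ x', ((v.1.2 i * x.1.2 i : ℤˣ) : ℤ) • (u v x * u v' x') := by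
        simp_rw [← Finset.smul_sum, ← Finset.mul_sum, hrowsum, mul_one]
    _ = ∑ x, ∑ x', ((v'.1.2 i * x'.1.2 i : ℤˣ) : ℤ) • (u v x * u v' x') := by
        refine Finset.sum_congr rfl fun x _ => Finset.sum_congr rfl fun x' _ => ?_
        by_cases hsign : v.1.2 i * x.1.2 i = v'.1.2 i * x'.1.2 i
        · rw [hsign]
        · rw [hqut.mul_eq_zero_of_sign_ne hidem hrow hcol hvv' hv hv' hsign, smul_zero, smul_zero]
    _ = ∑ x', ((v'.1.2 i * x'.1.2 i : ℤˣ) : ℤ) • u v' x' := by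
        rw [Finset.sum_comm]
        simp_rw [← Finset.smul_sum, ← Finset.sum_mul, hrowsum, one_mul]
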